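/- Let U ∈ ℝ^{p×q} and let k be a positive integer with k ≤ p. For each column j ∈ {1,…,q}, let I_j be a set of k row indices on which the absolute values of the entries of the j-th column of U are largest, and let I = ∪_j ({(i,j) : i ∈ I_j}). Assume U_I ≠ 0. Then S* = U_I/‖U_I‖_F belongs to E = {S ∈ ℝ^{p×q} : every column of S has at most k non-zero entries, ‖S‖_F = 1}, and for every S ∈ E one has ‖S* − U‖_F ≤ ‖S − U‖_F. -/

import Mathlib

noncomputable def frobNorm {p q : ℕ} (A : Matrix (Fin p) (Fin q) ℝ) : ℝ :=
  Real.sqrt (∑ i, ∑ j, A i j ^ 2)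

noncomputable def restrict {p q : ℕ} (A : Matrix (Fin p) (Fin q) ℝ)
    (T : Finset (Fin p × Fin q)) : Matrix (Fin p) (Fin q) ℝ :=
  Matrix.of fun i j => if (i, j) ∈ T then A i j else 0

open Classical in
/-- number of non-zero entries of the `j`-th column of `A` -/
noncomputable def colL0 {p q : ℕ} (A : Matrix (Fin p) (Fin q) ℝ) (j : Fin q) : ℕ :=
  (Finset.univ.filter fun i : Fin p => A i j ≠ 0).card

theorem frobNorm_nonneg {p q : ℕ} (A : Matrix (Fin p) (Fin q) ℝ) : 0 ≤ frobNorm A :=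
  Real.sqrt_nonneg _

theorem frobNorm_sq {p q : ℕ} (A : Matrix (Fin p) (Fin q) ℝ) :
    frobNorm A ^ 2 = ∑ i, ∑ j, A i j ^ 2 :=
  Real.sq_sqrt (Finset.sum_nonneg fun _ _ => Finset.sum_nonneg fun _ _ => sq_nonneg _)

theorem frobNorm_pos {p q : ℕ} {A : Matrix (Fin p) (Fin q) ℝ} (hA : A ≠ 0) :
    0 < frobNorm A := by
  obtain ⟨i, j, hij⟩ : ∃ i j, A i j ≠ 0 := by
    by_contra! h
    exact hA (Matrix.ext h)
  refine Real.sqrt_pos.2 (Finset.sum_pos'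
    (fun _ _ => Finset.sum_nonneg fun _ _ => sq_nonneg _) ⟨i, Finset.mem_univ _, ?_⟩)
  exact Finset.sum_pos' (fun _ _ => sq_nonneg _) ⟨j, Finset.mem_univ _, by positivity⟩

theorem frobNorm_smul {p q : ℕ} (c : ℝ) (A : Matrix (Fin p) (Fin q) ℝ) :
    frobNorm (c • A) = |c| * frobNorm A := by
  simp only [frobNorm, Matrix.smul_apply, smul_eq_mul, mul_pow, ← Finset.mul_sum]
  rw [Real.sqrt_mul (sq_nonneg c), Real.sqrt_sq_eq_abs]

theorem frobNorm_sub_sq {p q : ℕ} (A B : Matrix (Fin p) (Fin q) ℝ) :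
    frobNorm (A - B) ^ 2 =
      frobNorm A ^ 2 - 2 * (∑ i, ∑ j, A i j * B i j) + frobNorm B ^ 2 := by
  simp only [frobNorm_sq, Matrix.sub_apply, Finset.mul_sum, ← Finset.sum_sub_distrib,
    ← Finset.sum_add_distrib]
  exact Finset.sum_congr rfl fun _ _ => Finset.sum_congr rfl fun _ _ => by ring

/-- Cauchy–Schwarz inequality for the Frobenius inner product. -/
theorem sum_mul_le_frobNorm_mul_frobNorm {p q : ℕ} (A B : Matrix (Fin p) (Fin q) ℝ) :
    ∑ i, ∑ j, A i j * B i j ≤ frobNorm A * frobNorm B := by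
  refine le_of_abs_le (abs_le_of_sq_le_sq ?_ (mul_nonneg (frobNorm_nonneg A) (frobNorm_nonneg B)))
  rw [mul_pow, frobNorm_sq, frobNorm_sq]
  simp only [← Fintype.sum_prod_type']
  exact Finset.sum_mul_sq_le_sq_mul_sq _ _ _

theorem frobNorm_restrict_sq {p q : ℕ} (A : Matrix (Fin p) (Fin q) ℝ)
    (T : Finset (Fin p × Fin q)) :
    frobNorm (restrict A T) ^ 2 =
      ∑ j, ∑ i ∈ Finset.univ.filter (fun i => (i, j) ∈ T), A i j ^ 2 := by
  rw [frobNorm_sq, Finset.sum_comm]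
  simp [restrict, ite_pow, Finset.sum_filter]

/-- A set on which a nonnegative function takes its largest values maximizes the sum
among all sets of at most the same cardinality. -/
theorem sum_le_sum_of_card_le_of_forall_le {ι : Type*} [DecidableEq ι] {f : ι → ℝ}
    {s t : Finset ι} (hf : ∀ i, 0 ≤ f i) (hcard : t.card ≤ s.card)
    (hmax : ∀ a ∈ s, ∀ b ∉ s, f b ≤ f a) : ∑ i ∈ t, f i ≤ ∑ i ∈ s, f i := by
  rw [← Finset.sum_inter_add_sum_sdiff t s, ← Finset.sum_inter_add_sum_sdiff s t,
    Finset.inter_comm]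
  gcongr 1
  rcases (t \ s).eq_empty_or_nonempty with h | h
  · rw [h, Finset.sum_empty]
    exact Finset.sum_nonneg fun i _ => hf i
  obtain ⟨b, hb, hbmax⟩ := Finset.exists_max_image (t \ s) f h
  have hc : (t \ s).card ≤ (s \ t).card := by
    have h₁ := Finset.card_sdiff_add_card_inter t s
    have h₂ := Finset.card_sdiff_add_card_inter s t
    rw [Finset.inter_comm] at h₂
    omega
  calc ∑ i ∈ t \ s, f i ≤ (t \ s).card • f b := Finset.sum_le_card_nsmul _ _ _ hbmax
    _ ≤ (s \ t).card • f b := nsmul_le_nsmul_left (hf b) hc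
    _ ≤ ∑ i ∈ s \ t, f i := Finset.card_nsmul_le_sum _ _ _ fun a ha =>
        hmax a (Finset.mem_sdiff.1 ha).1 b (Finset.mem_sdiff.1 hb).2

/-- The projection of `U` onto the set of unit-Frobenius-norm matrices whose every column
has at most `k` non-zero entries is obtained by keeping, in each column, the `k`
largest-magnitude entries of `U`, zeroing the others, and normalizing. -/
theorem projection_columnwise_sparsity
    {p q : ℕ} (U : Matrix (Fin p) (Fin q) ℝ)
    (k : ℕ) (hk : 0 < k) (hkp : k ≤ p)
    (I : Fin q → Finset (Fin p))
    (hIcard : ∀ j, (I j).card = k)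
    (hImax : ∀ j, ∀ a ∈ I j, ∀ b ∉ I j, |U b j| ≤ |U a j|)
    (Itot : Finset (Fin p × Fin q))
    (hItot : Itot = Finset.univ.biUnion fun j : Fin q => (I j).image fun i => (i, j))
    (hne : restrict U Itot ≠ 0)
    (Sstar : Matrix (Fin p) (Fin q) ℝ)
    (hSstar : Sstar = (frobNorm (restrict U Itot))⁻¹ • restrict U Itot) :
    (∀ j, colL0 Sstar j ≤ k) ∧ frobNorm Sstar = 1 ∧
      ∀ S : Matrix (Fin p) (Fin q) ℝ, (∀ j, colL0 S j ≤ k) → frobNorm S = 1 →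
        frobNorm (Sstar - U) ≤ frobNorm (S - U) := by
  classical
  have hmem : ∀ i j, (i, j) ∈ Itot ↔ i ∈ I j := by
    intro i j
    simp [hItot]
  have hfilter : ∀ j, Finset.univ.filter (fun i => (i, j) ∈ Itot) = I j := by
    intro j
    ext i
    simp [hmem]
  have hpos := frobNorm_pos hne
  have hnorm : frobNorm Sstar = 1 := by
    rw [hSstar, frobNorm_smul, abs_of_pos (inv_pos.2 hpos), inv_mul_cancel₀ hpos.ne']
  have hinner : ∑ i, ∑ j, Sstar i j * U i j = frobNorm (restrict U Itot) := by
    have h : ∑ i, ∑ j, Sstar i j * U i j =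
        (frobNorm (restrict U Itot))⁻¹ * frobNorm (restrict U Itot) ^ 2 := by
      rw [frobNorm_sq, Finset.mul_sum]
      simp only [Finset.mul_sum]
      refine Finset.sum_congr rfl fun i _ => Finset.sum_congr rfl fun j _ => ?_
      rw [hSstar, Matrix.smul_apply, smul_eq_mul, mul_assoc]
      congr 1
      by_cases hij : (i, j) ∈ Itot <;> simp [restrict, hij, sq]
    rw [h]
    field_simp
  refine ⟨fun j => ?_, hnorm, fun S hS hS1 => ?_⟩
  · rw [← hIcard j]
    refine Finset.card_le_card fun i hi => ?_
    by_contra hij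
    simp [hSstar, restrict, hmem, hij] at hi
  · let T : Finset (Fin p × Fin q) := Finset.univ.filter fun x => S x.1 x.2 ≠ 0
    have hle : frobNorm (restrict U T) ≤ frobNorm (restrict U Itot) := by
      refine le_of_abs_le (abs_le_of_sq_le_sq ?_ hpos.le)
      rw [frobNorm_restrict_sq, frobNorm_restrict_sq]
      refine Finset.sum_le_sum fun j _ => ?_
      rw [hfilter]
      refine sum_le_sum_of_card_le_of_forall_le (fun _ => sq_nonneg _) ?_
        fun a ha b hb => sq_le_sq.2 (hImax j a ha b hb)
      rw [hIcard]
      convert hS j using 1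
      simp [colL0, T]
    have hS_inner : ∑ i, ∑ j, S i j * U i j ≤ frobNorm (restrict U T) := by
      calc ∑ i, ∑ j, S i j * U i j = ∑ i, ∑ j, S i j * restrict U T i j := by
            refine Finset.sum_congr rfl fun i _ => Finset.sum_congr rfl fun j _ => ?_
            by_cases hij : S i j = 0 <;> simp [restrict, T, hij]
        _ ≤ frobNorm (restrict U T) := by
            simpa [hS1] using sum_mul_le_frobNorm_mul_frobNorm S (restrict U T)
    refine le_of_abs_le (abs_le_of_sq_le_sq ?_ (frobNorm_nonneg _))
    rw [frobNorm_sub_sq, frobNorm_sub_sq, hnorm, hS1, hinner]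
    linarith
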